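/- Let E be a Polish space with its Borel σ-algebra, let ρ : E × E → [0,∞] be a lower semicontinuous metric on E, and let (κ_t)_{t≥0} be a Markov semigroup on E that acts as a contraction for ρ. Assume t ↦ W_ρ(κ_t(x), κ_t(y)) is Borel measurable for each x, y, and define h(x,y) := ∫_0^∞ W_ρ(κ_t(x), κ_t(y)) dt. Suppose there are T > 0 and α > 1 such that W_ρ(κ_T(x), κ_T(y)) ≤ ρ(x,y)/α for all x, y ∈ E. Then h(x,y) ≤ (α·T/(α − 1))·ρ(x,y) for all x, y ∈ E. -/

import Mathlib

open MeasureTheory ProbabilityTheory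

/-- The optimal coupling cost `W_ρ(μ, ν) = inf { ∫ ρ dπ : π a coupling of μ and ν }`. -/
noncomputable def couplingCost {E : Type*} [MeasurableSpace E]
    (ρ : E × E → ENNReal) (μ ν : Measure E) : ENNReal :=
  ⨅ π ∈ {π : Measure (E × E) |
      IsProbabilityMeasure π ∧ π.map Prod.fst = μ ∧ π.map Prod.snd = ν},
    ∫⁻ p, ρ p ∂π

open Filter Topology
open scoped ENNReal NNReal

section Auxiliary

variable {E : Type*} [MeasurableSpace E]

lemma couplingCost_le_lintegral {ρ : E × E → ℝ≥0∞} {μ ν : Measure E} (π : Measure (E × E))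
    [IsProbabilityMeasure π] (h₁ : π.map Prod.fst = μ) (h₂ : π.map Prod.snd = ν) :
    couplingCost ρ μ ν ≤ ∫⁻ p, ρ p ∂π :=
  iInf₂_le π ⟨inferInstance, h₁, h₂⟩

lemma exists_coupling_lintegral_le_add (ρ : E × E → ℝ≥0∞) (μ ν : Measure E)
    [IsProbabilityMeasure μ] [IsProbabilityMeasure ν] {ε : ℝ≥0∞} (hε : ε ≠ 0) :
    ∃ π : Measure (E × E), IsProbabilityMeasure π ∧ π.map Prod.fst = μ ∧ π.map Prod.snd = ν ∧
      ∫⁻ p, ρ p ∂π ≤ couplingCost ρ μ ν + ε := by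
  by_cases htop : couplingCost ρ μ ν = ∞
  · refine ⟨μ.prod ν, inferInstance, ?_, ?_, by simp [htop]⟩
    · simp
    · simp
  · have h : couplingCost ρ μ ν < couplingCost ρ μ ν + ε := ENNReal.lt_add_right htop hε
    conv_lhs at h => unfold couplingCost
    simp only [iInf_lt_iff] at h
    obtain ⟨π, ⟨hπ, h₁, h₂⟩, hlt⟩ := h
    exact ⟨π, hπ, h₁, h₂, hlt.le⟩

/-- Gluing near-optimal couplings of the transition laws along a fine countable partition. -/
lemma exists_approx_coupling_bind {ρ : E × E → ℝ≥0∞} (hρ : Measurable ρ) (κ : Kernel E E)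
    [IsMarkovKernel κ] {c : ℝ≥0∞} (hκ : ∀ x y, couplingCost ρ (κ x) (κ y) ≤ c * ρ (x, y))
    (π : Measure (E × E)) [IsProbabilityMeasure π] {ι : Type*} [Finite ι] {s : ι → Set E}
    (hs : ∀ j, MeasurableSet (s j)) {ε : ℝ} (hε : 0 < ε) :
    ∃ π' : Measure (E × E), IsProbabilityMeasure π' ∧
      ∫⁻ p, ρ p ∂π' ≤ c * ∫⁻ p, ρ p ∂π + ENNReal.ofReal ε ∧
      (∀ j, (π.map Prod.fst).bind κ (s j) ≤ π'.map Prod.fst (s j) + ENNReal.ofReal ε) ∧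
      ∀ j, (π.map Prod.snd).bind κ (s j) ≤ π'.map Prod.snd (s j) + ENNReal.ofReal ε := by
  obtain ⟨q⟩ := π.nonempty_of_neZero
  have hε2 : ENNReal.ofReal ε / 2 ≠ 0 := by simpa using hε
  let f : E → ι → ℤ := fun x j ↦ ⌊(κ x (s j)).toReal / ε⌋
  have hf : Measurable f := measurable_pi_lambda _ fun j ↦
    ((κ.measurable_coe (hs j)).ennreal_toReal.div_const ε).floor
  have hclose : ∀ x y, f x = f y → ∀ j, κ x (s j) ≤ κ y (s j) + ENNReal.ofReal ε := by
    intro x y hxy j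
    have h := (abs_lt.1 (Int.abs_sub_lt_one_of_floor_eq_floor (congrFun hxy j))).2
    rw [← sub_div, div_lt_one hε] at h
    rw [← ENNReal.ofReal_toReal (measure_ne_top (κ x) (s j)),
      ← ENNReal.ofReal_toReal (measure_ne_top (κ y) (s j)),
      ← ENNReal.ofReal_add ENNReal.toReal_nonneg hε.le]
    exact ENNReal.ofReal_le_ofReal (by linarith)
  let g : E × E → (ι → ℤ) × (ι → ℤ) := fun p ↦ (f p.1, f p.2)
  have hg : Measurable g := (hf.comp measurable_fst).prodMk (hf.comp measurable_snd)
  have hcell : ∀ d, ∃ η : Measure (E × E), IsProbabilityMeasure η ∧ ∀ p, g p = d →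
      ∫⁻ z, ρ z ∂η ≤ c * ρ p + ENNReal.ofReal ε ∧
      (∀ j, κ p.1 (s j) ≤ η.map Prod.fst (s j) + ENNReal.ofReal ε) ∧
      ∀ j, κ p.2 (s j) ≤ η.map Prod.snd (s j) + ENNReal.ofReal ε := by
    intro d
    by_cases hd : ∃ p, g p = d
    · obtain ⟨p₀, hp₀, hmin⟩ : ∃ p₀, g p₀ = d ∧
          ∀ p, g p = d → c * ρ p₀ ≤ c * ρ p + ENNReal.ofReal ε / 2 := by
        by_cases htop : (⨅ (p) (_ : g p = d), c * ρ p) = ∞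
        · obtain ⟨p₀, hp₀⟩ := hd
          refine ⟨p₀, hp₀, fun p hp ↦ ?_⟩
          have : c * ρ p = ∞ := by
            simp only [iInf_eq_top] at htop
            exact htop p hp
          simp [this]
        · have h := ENNReal.lt_add_right htop hε2
          obtain ⟨p₀, h⟩ := iInf_lt_iff.1 h
          obtain ⟨hp₀, h⟩ := iInf_lt_iff.1 h
          refine ⟨p₀, hp₀, fun p hp ↦ h.le.trans ?_⟩
          gcongr
          exact iInf₂_le p hp
      obtain ⟨η, hη, h₁, h₂, hle⟩ :=
        exists_coupling_lintegral_le_add ρ (κ p₀.1) (κ p₀.2) hε2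
      refine ⟨η, hη, fun p hp ↦ ⟨?_, ?_, ?_⟩⟩
      · calc ∫⁻ z, ρ z ∂η ≤ c * ρ p₀ + ENNReal.ofReal ε / 2 :=
              hle.trans (by gcongr; exact hκ p₀.1 p₀.2)
          _ ≤ c * ρ p + ENNReal.ofReal ε / 2 + ENNReal.ofReal ε / 2 := by
              gcongr ?_ + _
              exact hmin p hp
          _ = _ := by rw [add_assoc, ENNReal.add_halves]
      · rw [h₁]
        exact hclose _ _ (congrArg Prod.fst (hp.trans hp₀.symm))
      · rw [h₂]
        exact hclose _ _ (congrArg Prod.snd (hp.trans hp₀.symm))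
    · exact ⟨Measure.dirac q, inferInstance, fun p hp ↦ absurd ⟨p, hp⟩ hd⟩
  choose η hη hcell using hcell
  have hK : Measurable fun p ↦ η (g p) := (measurable_of_countable η).comp hg
  have key : ∀ φ : E × E → E, Measurable φ →
      (∀ p j, κ (φ p) (s j) ≤ (η (g p)).map φ (s j) + ENNReal.ofReal ε) →
      ∀ j, (π.map φ).bind κ (s j) ≤
        (π.bind fun p ↦ η (g p)).map φ (s j) + ENNReal.ofReal ε := by
    intro φ hφ hle j
    rw [Measure.bind_apply (hs j) κ.measurable.aemeasurable,
      lintegral_map (κ.measurable_coe (hs j)) hφ, Measure.map_apply hφ (hs j),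
      Measure.bind_apply (hφ (hs j)) hK.aemeasurable]
    calc ∫⁻ p, κ (φ p) (s j) ∂π ≤ ∫⁻ p, (η (g p) (φ ⁻¹' s j) + ENNReal.ofReal ε) ∂π := by
          refine lintegral_mono fun p ↦ ?_
          rw [← Measure.map_apply hφ (hs j)]
          exact hle p j
      _ = _ := by rw [lintegral_add_right _ measurable_const]; simp
  refine ⟨π.bind fun p ↦ η (g p),
    isProbabilityMeasure_bind hK.aemeasurable (ae_of_all _ fun p ↦ hη (g p)), ?_,
    key _ measurable_fst fun p ↦ (hcell _ p rfl).2.1, key _ measurable_snd fun p ↦ (hcell _ p rfl).2.2⟩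
  rw [Measure.lintegral_bind hK.aemeasurable hρ.aemeasurable]
  calc ∫⁻ p, ∫⁻ z, ρ z ∂η (g p) ∂π ≤ ∫⁻ p, (c * ρ p + ENNReal.ofReal ε) ∂π :=
        lintegral_mono fun p ↦ (hcell _ p rfl).1
    _ = _ := by rw [lintegral_add_right _ measurable_const, lintegral_const_mul _ hρ]; simp

/-- Layer cake formula for `ℝ≥0∞`-valued functions. -/
lemma lintegral_eq_lintegral_meas_ofReal_lt {Ω : Type*} [MeasurableSpace Ω] (μ : Measure Ω)
    [SFinite μ] {f : Ω → ℝ≥0∞} (hf : Measurable f) :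
    ∫⁻ x, f x ∂μ = ∫⁻ t in Set.Ioi (0 : ℝ), μ {x | ENNReal.ofReal t < f x} := by
  have hS : MeasurableSet {z : Ω × ℝ | ENNReal.ofReal z.2 < f z.1} :=
    measurableSet_lt (ENNReal.measurable_ofReal.comp measurable_snd) (hf.comp measurable_fst)
  have hvol : ∀ a : ℝ≥0∞, volume.restrict (Set.Ioi (0 : ℝ)) {t | ENNReal.ofReal t < a} = a := by
    intro a
    rw [Measure.restrict_apply (measurableSet_lt ENNReal.measurable_ofReal measurable_const)]
    induction a with
    | top =>
      have : {t : ℝ | ENNReal.ofReal t < ∞} ∩ Set.Ioi 0 = Set.Ioi 0 := by ext; simp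
      rw [this, Real.volume_Ioi]
    | coe a =>
      have : {t : ℝ | ENNReal.ofReal t < a} ∩ Set.Ioi 0 = Set.Ioo 0 (a : ℝ) := by
        ext t
        simp only [Set.mem_inter_iff, Set.mem_ofPred_eq, Set.mem_Ioi, Set.mem_Ioo]
        constructor
        · rintro ⟨h, h0⟩
          refine ⟨h0, ?_⟩
          rw [← ENNReal.ofReal_coe_nnreal] at h
          exact (ENNReal.ofReal_lt_ofReal_iff'.1 h).1
        · rintro ⟨h0, h⟩
          refine ⟨?_, h0⟩
          rw [← ENNReal.ofReal_coe_nnreal]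
          exact ENNReal.ofReal_lt_ofReal_iff'.2 ⟨h, h0.trans h⟩
      rw [this, Real.volume_Ioo]
      simp
  calc ∫⁻ x, f x ∂μ
      = ∫⁻ x, volume.restrict (Set.Ioi (0 : ℝ)) {t | ENNReal.ofReal t < f x} ∂μ := by
        simp_rw [hvol]
    _ = (μ.prod (volume.restrict (Set.Ioi (0 : ℝ)))) {z | ENNReal.ofReal z.2 < f z.1} :=
        (Measure.prod_apply hS).symm
    _ = _ := Measure.prod_apply_symm hS

lemma lintegral_le_liminf_lintegral_of_lowerSemicontinuous {Ω : Type*} [MeasurableSpace Ω]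
    [TopologicalSpace Ω] [OpensMeasurableSpace Ω] [HasOuterApproxClosed Ω] {f : Ω → ℝ≥0∞}
    (hf : LowerSemicontinuous f) {μ : ProbabilityMeasure Ω} {μs : ℕ → ProbabilityMeasure Ω}
    (h : Tendsto μs atTop (𝓝 μ)) :
    ∫⁻ x, f x ∂(μ : Measure Ω) ≤ liminf (fun n ↦ ∫⁻ x, f x ∂(μs n : Measure Ω)) atTop := by
  simp_rw [lintegral_eq_lintegral_meas_ofReal_lt _ hf.measurable]
  refine (lintegral_mono fun t ↦ ProbabilityMeasure.le_liminf_measure_open_of_tendsto h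
    (hf.isOpen_preimage (ENNReal.ofReal t))).trans ?_
  refine lintegral_liminf_le fun n ↦ Antitone.measurable fun a b hab ↦ ?_
  exact measure_mono fun x hx ↦ (ENNReal.ofReal_le_ofReal hab).trans_lt hx

end Auxiliary

section Polish

variable {E : Type*} [TopologicalSpace E] [PolishSpace E] [MeasurableSpace E] [BorelSpace E]

lemma couplingCost_le_of_tendsto {ρ : E × E → ℝ≥0∞} (hρ : LowerSemicontinuous ρ)
    {μ ν : ProbabilityMeasure E} {πs : ℕ → ProbabilityMeasure (E × E)}
    (h₁ : Tendsto (fun n ↦ (πs n).map continuous_fst.aemeasurable) atTop (𝓝 μ))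
    (h₂ : Tendsto (fun n ↦ (πs n).map continuous_snd.aemeasurable) atTop (𝓝 ν))
    {a : ℕ → ℝ≥0∞} {C : ℝ≥0∞} (ha : Tendsto a atTop (𝓝 C))
    (hle : ∀ n, ∫⁻ p, ρ p ∂(πs n : Measure (E × E)) ≤ a n) :
    couplingCost ρ μ ν ≤ C := by
  let _ := TopologicalSpace.upgradeIsCompletelyMetrizable E
  have tight : ∀ {μs : ℕ → ProbabilityMeasure E} {μ : ProbabilityMeasure E},
      Tendsto μs atTop (𝓝 μ) →
      IsTightMeasureSet {((μ : ProbabilityMeasure E) : Measure E) | μ ∈ Set.range μs} := by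
    intro μs μ h
    refine isTightMeasureSet_of_isCompact_closure (h.isCompact_insert_range.of_isClosed_subset
      isClosed_closure ?_)
    exact closure_minimal (Set.subset_insert _ _) h.isCompact_insert_range.isClosed
  have htight : IsTightMeasureSet
      {((π : ProbabilityMeasure (E × E)) : Measure (E × E)) | π ∈ Set.range πs} := by
    refine IsTightMeasureSet.prodMk ((tight h₁).subset ?_) ((tight h₂).subset ?_)
    · rintro _ ⟨_, ⟨_, ⟨n, rfl⟩, rfl⟩, rfl⟩
      exact ⟨_, ⟨n, rfl⟩, rfl⟩
    · rintro _ ⟨_, ⟨_, ⟨n, rfl⟩, rfl⟩, rfl⟩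
      exact ⟨_, ⟨n, rfl⟩, rfl⟩
  obtain ⟨π, -, φ, hφ, hlim⟩ := (isCompact_closure_of_isTightMeasureSet htight).tendsto_subseq
    (fun n ↦ subset_closure (Set.mem_range_self n))
  have e₁ : π.map continuous_fst.aemeasurable = μ := tendsto_nhds_unique
    (ProbabilityMeasure.tendsto_map_of_tendsto_of_continuous _ π hlim continuous_fst)
    (h₁.comp hφ.tendsto_atTop)
  have e₂ : π.map continuous_snd.aemeasurable = ν := tendsto_nhds_unique
    (ProbabilityMeasure.tendsto_map_of_tendsto_of_continuous _ π hlim continuous_snd)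
    (h₂.comp hφ.tendsto_atTop)
  calc couplingCost ρ μ ν ≤ ∫⁻ p, ρ p ∂(π : Measure (E × E)) :=
        couplingCost_le_lintegral _ (congrArg Subtype.val e₁) (congrArg Subtype.val e₂)
    _ ≤ liminf (fun n ↦ ∫⁻ p, ρ p ∂(πs (φ n) : Measure (E × E))) atTop :=
        lintegral_le_liminf_lintegral_of_lowerSemicontinuous hρ hlim
    _ ≤ liminf (fun n ↦ a (φ n)) atTop := liminf_le_liminf (.of_forall fun n ↦ hle _)
    _ = C := (ha.comp hφ.tendsto_atTop).liminf_eq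

variable (E) in
/-- Countably many open sets suffice to test weak convergence. -/
lemma exists_seq_isOpen_tendsto_probabilityMeasure : ∃ U : ℕ → Set E, (∀ j, IsOpen (U j)) ∧
    ∀ (μ : ProbabilityMeasure E) (μs : ℕ → ProbabilityMeasure E) (e : ℕ → ℝ≥0∞),
      Tendsto e atTop (𝓝 0) →
      (∀ n, ∀ j < n, (μ : Measure E) (U j) ≤ (μs n : Measure E) (U j) + e n) →
      Tendsto μs atTop (𝓝 μ) := by
  have hcount : {T : Set (Set E) | T.Finite ∧ T ⊆ TopologicalSpace.countableBasis E}.Countable :=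
    Set.countable_ofPred_finite_subset (TopologicalSpace.countable_countableBasis E)
  obtain ⟨V, hV⟩ := hcount.exists_eq_range ⟨∅, Set.finite_empty, Set.empty_subset _⟩
  refine ⟨fun j ↦ ⋃₀ V j, fun j ↦ isOpen_sUnion fun t ht ↦ ?_, fun μ μs e he hle ↦ ?_⟩
  · have : V j ∈ Set.range V := ⟨j, rfl⟩
    rw [← hV] at this
    exact TopologicalSpace.isOpen_of_mem_countableBasis (this.2 ht)
  refine tendsto_of_forall_isOpen_le_liminf_nat' fun G hG ↦ le_of_forall_lt fun r hr ↦ ?_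
  lift r to ℝ≥0 using hr.ne_top
  obtain ⟨T, hT, hlt, hTG⟩ := μ.exists_lt_measure_biUnion_of_isOpen
    (S := TopologicalSpace.countableBasis E)
    (fun u hu x hx ↦ by
      obtain ⟨s, hs, hxs, hsu⟩ := (TopologicalSpace.isBasis_countableBasis E).exists_subset_of_mem_open
        hx hu
      exact ⟨s, hs, (TopologicalSpace.isOpen_of_mem_countableBasis hs).mem_nhds hxs, hsu⟩)
    hG (r := r) (by rwa [← ENNReal.coe_lt_coe, ProbabilityMeasure.ennreal_coeFn_eq_coeFn_toMeasure])
  rw [← ENNReal.coe_lt_coe, ProbabilityMeasure.ennreal_coeFn_eq_coeFn_toMeasure] at hlt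
  obtain ⟨r', hrr', hlt⟩ := exists_between hlt
  obtain ⟨j, hj⟩ : (T : Set (Set E)) ∈ Set.range V := hV ▸ ⟨T.finite_toSet, hT⟩
  have hU : ⋃₀ V j = ⋃ t ∈ T, t := by rw [hj, Set.sUnion_eq_biUnion]; simp
  refine hrr'.trans_le (le_liminf_of_le (by isBoundedDefault) ?_)
  have hev : ∀ᶠ n in atTop, r' + e n < (μ : Measure E) (⋃ t ∈ T, t) :=
    (by simpa using he.const_add r' : Tendsto (fun n ↦ r' + e n) atTop (𝓝 r')).eventually_lt_const
      hlt
  filter_upwards [hev, eventually_gt_atTop j] with n hn hjn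
  have h : (μ : Measure E) (⋃₀ V j) ≤ (μs n : Measure E) (⋃₀ V j) + e n := hle n j hjn
  rw [hU] at h
  exact (lt_of_add_lt_add_right (hn.trans_le h)).le.trans (measure_mono hTG)

lemma couplingCost_bind_le {ρ : E × E → ℝ≥0∞} (hρ : LowerSemicontinuous ρ) (κ : Kernel E E)
    [IsMarkovKernel κ] {c : ℝ≥0∞} (hκ : ∀ x y, couplingCost ρ (κ x) (κ y) ≤ c * ρ (x, y))
    (hc₀ : c ≠ 0) (hc : c ≠ ∞) (μ ν : Measure E) [IsProbabilityMeasure μ] [IsProbabilityMeasure ν] :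
    couplingCost ρ (μ.bind κ) (ν.bind κ) ≤ c * couplingCost ρ μ ν := by
  have main : ∀ π : Measure (E × E), IsProbabilityMeasure π → π.map Prod.fst = μ →
      π.map Prod.snd = ν → couplingCost ρ (μ.bind κ) (ν.bind κ) ≤ c * ∫⁻ p, ρ p ∂π := by
    intro π hπ h₁ h₂
    obtain ⟨U, hU, hconv⟩ := exists_seq_isOpen_tendsto_probabilityMeasure E
    let ε : ℕ → ℝ := fun n ↦ 1 / ((n : ℝ) + 1)
    have hε : Tendsto (fun n ↦ ENNReal.ofReal (ε n)) atTop (𝓝 0) := by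
      simpa only [ENNReal.ofReal_zero] using ENNReal.tendsto_ofReal tendsto_one_div_add_atTop_nhds_zero_nat
    choose πs hπs hcost hfst hsnd using fun n : ℕ ↦ exists_approx_coupling_bind hρ.measurable κ hκ
      π (s := fun j : Fin n ↦ U j) (fun j ↦ (hU j).measurableSet)
      (Nat.one_div_pos_of_nat : 0 < ε n)
    have hb : ∀ (m : Measure E) [IsProbabilityMeasure m], IsProbabilityMeasure (m.bind κ) :=
      fun m _ ↦ isProbabilityMeasure_bind κ.measurable.aemeasurable
        (ae_of_all _ fun _ ↦ inferInstance)
    rw [h₁] at hfst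
    rw [h₂] at hsnd
    refine couplingCost_le_of_tendsto hρ (μ := ⟨μ.bind κ, hb μ⟩) (ν := ⟨ν.bind κ, hb ν⟩)
      (πs := fun n ↦ ⟨πs n, hπs n⟩)
      (hconv _ _ _ hε fun n j hj ↦ hfst n ⟨j, hj⟩) (hconv _ _ _ hε fun n j hj ↦ hsnd n ⟨j, hj⟩)
      (a := fun n ↦ c * ∫⁻ p, ρ p ∂π + ENNReal.ofReal (ε n)) ?_ hcost
    simpa using hε.const_add (c * ∫⁻ p, ρ p ∂π)
  conv_rhs => unfold couplingCost
  simp only [ENNReal.mul_iInf_of_ne hc₀ hc]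
  exact le_iInf₂ fun π hπ ↦ main π hπ.1 hπ.2.1 hπ.2.2

end Polish

/-- A function on the half-line which is bounded by `b` and contracts by a factor `α > 1` over each
period `T` has integral at most `α T / (α - 1) * b`. -/
lemma lintegral_Ioi_le_of_contracting {g : ℝ → ℝ≥0∞} {b : ℝ≥0∞} {T α : ℝ} (hT : 0 < T)
    (hα : 1 < α) (hb : ∀ t, 0 ≤ t → g t ≤ b)
    (hcontr : ∀ t, 0 ≤ t → g (t + T) ≤ (ENNReal.ofReal α)⁻¹ * g t) :
    ∫⁻ t in Set.Ioi (0 : ℝ), g t ≤ ENNReal.ofReal (α * T / (α - 1)) * b := by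
  have hα0 : 0 < α := by linarith
  have hα1 : 0 < α - 1 := by linarith
  have step : ∀ n : ℕ, ∫⁻ t in Set.Ioc (0 : ℝ) (n * T), g t ≤
      ENNReal.ofReal (α * T / (α - 1)) * b := by
    intro n
    induction n with
    | zero => simp
    | succ n ih =>
      have hsplit : Set.Ioc (0 : ℝ) ((n + 1 : ℕ) * T) ⊆
          Set.Ioc 0 T ∪ Set.Ioc (0 + T) (n * T + T) := by
        intro t ht
        push_cast at ht
        by_cases h : t ≤ T
        · exact Or.inl ⟨ht.1, h⟩
        · exact Or.inr ⟨by linarith, by linarith [ht.2]⟩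
      have hshift : ∫⁻ t in Set.Ioc (0 + T) (n * T + T), g t =
          ∫⁻ t in Set.Ioc (0 : ℝ) (n * T), g (t + T) := by
        rw [← Set.image_add_const_Ioc]
        exact ((measurePreserving_add_right volume T).setLIntegral_comp_emb
          (measurableEmbedding_addRight T) g _).symm
      calc ∫⁻ t in Set.Ioc (0 : ℝ) ((n + 1 : ℕ) * T), g t
          ≤ (∫⁻ t in Set.Ioc 0 T, g t) + ∫⁻ t in Set.Ioc (0 + T) (n * T + T), g t :=
            (lintegral_mono_set hsplit).trans (lintegral_union_le _ _ _)
        _ ≤ ENNReal.ofReal T * b + (ENNReal.ofReal α)⁻¹ *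
              (ENNReal.ofReal (α * T / (α - 1)) * b) := by
            rw [hshift]
            gcongr
            · refine (setLIntegral_mono' measurableSet_Ioc fun t ht ↦ hb t ht.1.le).trans ?_
              simp [mul_comm]
            · refine (setLIntegral_mono' measurableSet_Ioc fun t ht ↦
                hcontr t ht.1.le).trans ?_
              rw [lintegral_const_mul' _ _ (by simpa using hα0)]
              gcongr
        _ = ENNReal.ofReal (α * T / (α - 1)) * b := by
            rw [← mul_assoc, ← add_mul, ← ENNReal.ofReal_inv_of_pos hα0,
              ← ENNReal.ofReal_mul (by positivity), ← ENNReal.ofReal_add hT.le (by positivity)]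
            congr 2
            field_simp
            ring
  have hmono : Monotone fun n : ℕ ↦ Set.Ioc (0 : ℝ) (n * T) := fun m n hmn ↦
    Set.Ioc_subset_Ioc_right (by gcongr)
  have hunion : Set.Ioi (0 : ℝ) = ⋃ n : ℕ, Set.Ioc (0 : ℝ) (n * T) := by
    ext t
    simp only [Set.mem_Ioi, Set.mem_iUnion, Set.mem_Ioc, exists_and_left, iff_self_and]
    intro _
    obtain ⟨n, hn⟩ := exists_nat_ge (t / T)
    exact ⟨n, (div_le_iff₀ hT).1 hn⟩
  rw [hunion, setLIntegral_iUnion_of_directed _ hmono.directed_le]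
  exact iSup_le step

theorem stmt_10 {E : Type*} [TopologicalSpace E] [PolishSpace E]
    [MeasurableSpace E] [BorelSpace E]
    (ρ : E × E → ENNReal) (hρ_lsc : LowerSemicontinuous ρ)
    (hρ_eq : ∀ x y : E, ρ (x, y) = 0 ↔ x = y)
    (hρ_symm : ∀ x y : E, ρ (x, y) = ρ (y, x))
    (hρ_tri : ∀ x y z : E, ρ (x, y) ≤ ρ (x, z) + ρ (z, y))
    (κ : ℝ → Kernel E E)
    (hmk : ∀ t : ℝ, 0 ≤ t → IsMarkovKernel (κ t))
    (hsg : ∀ s t : ℝ, 0 ≤ s → 0 ≤ t → ∀ x : E, κ (t + s) x = (κ t x).bind (κ s))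
    (hcontr : ∀ t : ℝ, 0 ≤ t → ∀ x y : E, couplingCost ρ (κ t x) (κ t y) ≤ ρ (x, y))
    (hWmeas : ∀ x y : E, Measurable fun t : ℝ => couplingCost ρ (κ t x) (κ t y))
    (T α : ℝ) (hT : 0 < T) (hα : 1 < α)
    (hcontrT : ∀ x y : E, couplingCost ρ (κ T x) (κ T y) ≤ ρ (x, y) / ENNReal.ofReal α) :
    ∀ x y : E,
      (∫⁻ t in Set.Ioi (0:ℝ), couplingCost ρ (κ t x) (κ t y)) ≤
        ENNReal.ofReal (α * T / (α - 1)) * ρ (x, y) := by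
  intro x y
  refine lintegral_Ioi_le_of_contracting hT hα (fun t ht ↦ hcontr t ht x y) fun t ht ↦ ?_
  have := hmk t ht
  have := hmk T hT.le
  rw [hsg T t hT.le ht x, hsg T t hT.le ht y]
  refine couplingCost_bind_le hρ_lsc (κ T) (fun x y ↦ ?_) ?_ ?_ _ _
  · rw [mul_comm, ← div_eq_mul_inv]
    exact hcontrT x y
  · simp
  · simpa using zero_lt_one.trans hα
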